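/- Let k be a field and p a nonzero element of k. In the free associative algebra k⟨x,y⟩, the element y·x·y·x^2 + p⁻¹·y·x^2·y·x - p⁻³·x·y·x^2·y - p⁻⁴·x^2·y·x·y belongs to the two-sided ideal generated by x·y^2 - p^2·y^2·x and x^3·y + p·x^2·y·x + p^2·x·y·x^2 + p^3·y·x^3. -/

import Mathlib

theorem stmt_12 (k : Type*) [Field k] (p : k) (hp : p ≠ 0)
    (x y : FreeAlgebra k (Fin 2))
    (hx : x = FreeAlgebra.ι k 0) (hy : y = FreeAlgebra.ι k 1) :
    y * x * y * x^2 + algebraMap k (FreeAlgebra k (Fin 2)) p⁻¹ * (y * x^2 * y * x)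
      - algebraMap k (FreeAlgebra k (Fin 2)) (p⁻¹^3) * (x * y * x^2 * y)
      - algebraMap k (FreeAlgebra k (Fin 2)) (p⁻¹^4) * (x^2 * y * x * y) ∈
    TwoSidedIdeal.span
      {x * y^2 - algebraMap k (FreeAlgebra k (Fin 2)) (p^2) * (y^2 * x),
       x^3 * y + algebraMap k (FreeAlgebra k (Fin 2)) p * (x^2 * y * x)
         + algebraMap k (FreeAlgebra k (Fin 2)) (p^2) * (x * y * x^2)
         + algebraMap k (FreeAlgebra k (Fin 2)) (p^3) * (y * x^3)} := by
  clear hx hy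
  simp only [← Algebra.smul_def]
  set a := x * y^2 - (p^2) • (y^2 * x) with ha
  set b := x^3 * y + p • (x^2 * y * x) + (p^2) • (x * y * x^2) + (p^3) • (y * x^3) with hb
  set I := TwoSidedIdeal.span {a, b} with hI
  have haI : a ∈ I := TwoSidedIdeal.subset_span (by simp)
  have hbI : b ∈ I := TwoSidedIdeal.subset_span (by simp)
  have hs : ∀ (c : k) (z : FreeAlgebra k (Fin 2)), z ∈ I → c • z ∈ I := by
    intro c z hz
    rw [Algebra.smul_def]
    exact I.mul_mem_left _ _ hz
  have key : y * x * y * x^2 + p⁻¹ • (y * x^2 * y * x) - (p⁻¹^3) • (x * y * x^2 * y)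
      - (p⁻¹^4) • (x^2 * y * x * y)
      = (p⁻¹^2) • (y * b) - (p⁻¹^5) • (b * y)
        + ((p⁻¹^5) • (x^2 * a) + (p⁻¹^3) • (x * a * x) + p⁻¹ • (a * x^2)) := by
    rw [ha, hb]
    simp only [mul_add, add_mul, mul_sub, sub_mul, smul_mul_assoc, mul_smul_comm, smul_add,
      smul_sub, smul_smul, pow_succ, pow_zero, one_mul, mul_assoc]
    match_scalars <;> field_simp <;> ring
  rw [key]
  exact I.add_mem (I.sub_mem (hs _ _ (I.mul_mem_left _ _ hbI)) (hs _ _ (I.mul_mem_right _ _ hbI)))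
    (I.add_mem (I.add_mem (hs _ _ (I.mul_mem_left _ _ haI))
      (hs _ _ (I.mul_mem_right _ _ (I.mul_mem_left _ _ haI))))
      (hs _ _ (I.mul_mem_right _ _ haI)))
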